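/- arXiv:2509.15441 — 3 statements merged into one kernel-verified Lean document; each statement's English description precedes it below -/
import Mathlib

section
/- Let F, G : ℝ^n → ℝ^p be functions, set ν = F − G, and let A ∈ ℝ^{q×p}, b ∈ ℝ^q. Define G'(x) = A₊G(x) + A₋F(x), H'(x) = A₊F(x) + A₋G(x) + b, and F'(x) = max(H'(x), G'(x)) componentwise. Then for every x ∈ ℝ^n, the post-activation output satisfies ReLU(Aν(x) + b) = F'(x) − G'(x). -/
/-- Entrywise positive part of a matrix: entries `max (A i j) 0`. -/
noncomputable def matPos {m n : ℕ} (A : Matrix (Fin m) (Fin n) ℝ) : Matrix (Fin m) (Fin n) ℝ :=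
  fun i j => max (A i j) 0

/-- Entrywise negative part of a matrix: entries `max (-A i j) 0`. -/
noncomputable def matNeg {m n : ℕ} (A : Matrix (Fin m) (Fin n) ℝ) : Matrix (Fin m) (Fin n) ℝ :=
  fun i j => max (-A i j) 0

/-- Componentwise ReLU of a vector. -/
noncomputable def relu {m : ℕ} (y : Fin m → ℝ) : Fin m → ℝ := fun i => max (y i) 0

/-- Componentwise maximum of two vectors. -/
noncomputable def vmax {m : ℕ} (u w : Fin m → ℝ) : Fin m → ℝ := fun i => max (u i) (w i)

/-- With `ν = F − G`, `G' = A₊ G + A₋ F`, `H' = A₊ F + A₋ G + b` and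
`F' = max(H', G')` componentwise, the post-activation output satisfies
`ReLU (A ν(x) + b) = F'(x) − G'(x)`. -/
theorem postactivation_eq_F_sub_G {n p q : ℕ}
    (F G : (Fin n → ℝ) → (Fin p → ℝ)) (ν : (Fin n → ℝ) → (Fin p → ℝ))
    (hν : ν = F - G)
    (A : Matrix (Fin q) (Fin p) ℝ) (b : Fin q → ℝ)
    (G' H' F' : (Fin n → ℝ) → (Fin q → ℝ))
    (hG' : ∀ x, G' x = (matPos A).mulVec (G x) + (matNeg A).mulVec (F x))
    (hH' : ∀ x, H' x = (matPos A).mulVec (F x) + (matNeg A).mulVec (G x) + b)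
    (hF' : ∀ x, F' x = vmax (H' x) (G' x)) :
    ∀ x, relu (A.mulVec (ν x) + b) = F' x - G' x := by
  have hA : A = matPos A - matNeg A := by
    ext i j
    simp only [Matrix.sub_apply, matPos, matNeg]
    rcases le_total (A i j) 0 with h | h
    · rw [max_eq_right h, max_eq_left (by linarith)]; ring
    · rw [max_eq_left h, max_eq_right (by linarith)]; ring
  intro x
  have key : A.mulVec (ν x) + b = H' x - G' x := by
    rw [hG', hH', hν]
    conv_lhs => rw [hA]
    rw [Pi.sub_apply, Matrix.sub_mulVec, Matrix.mulVec_sub, Matrix.mulVec_sub]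
    abel
  rw [key, hF']
  funext i
  simp only [relu, vmax, Pi.sub_apply]
  rw [← max_sub_sub_right, sub_self]
end

section
/- For an L-layer ReLU network, the functions F^(ℓ), G^(ℓ) defined by the tropical recurrence satisfy ν^(ℓ) = F^(ℓ) − G^(ℓ) for every 0 ≤ ℓ ≤ L, and every coordinate function of F^(ℓ) and of G^(ℓ) is a pointwise maximum of finitely many affine functions on ℝ^{n_0}. In particular, every ReLU network is a difference of two coordinatewise convex piecewise-linear (tropical polynomial) maps. -/
open Matrix

/-- Post-activation outputs of a ReLU network with widths `n 0, n 1, …` and layer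
parameters `A ℓ : ℝ^{n (ℓ+1) × n ℓ}`, `b ℓ : ℝ^{n (ℓ+1)}`:
`ν⁰(x) = x` and `ν^{ℓ+1}(x) = ReLU (A ℓ · ν^ℓ(x) + b ℓ)`. -/
noncomputable def nu {n : ℕ → ℕ} (A : ∀ ℓ : ℕ, Matrix (Fin (n (ℓ + 1))) (Fin (n ℓ)) ℝ)
    (b : ∀ ℓ : ℕ, Fin (n (ℓ + 1)) → ℝ) : (ℓ : ℕ) → (Fin (n 0) → ℝ) → (Fin (n ℓ) → ℝ)
  | 0 => fun x => x
  | ℓ + 1 => fun x => relu ((A ℓ).mulVec (nu A b ℓ x) + b ℓ)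

/-- The tropical recurrence: `FG ℓ = (F^ℓ, G^ℓ)` with `F⁰(x) = x`, `G⁰(x) = 0`,
`G^{ℓ+1} = A₊ G^ℓ + A₋ F^ℓ`, `H^{ℓ+1} = A₊ F^ℓ + A₋ G^ℓ + b`,
`F^{ℓ+1} = max (H^{ℓ+1}, G^{ℓ+1})` componentwise. -/
noncomputable def FG {n : ℕ → ℕ} (A : ∀ ℓ : ℕ, Matrix (Fin (n (ℓ + 1))) (Fin (n ℓ)) ℝ)
    (b : ∀ ℓ : ℕ, Fin (n (ℓ + 1)) → ℝ) :
    (ℓ : ℕ) → ((Fin (n 0) → ℝ) → (Fin (n ℓ) → ℝ)) × ((Fin (n 0) → ℝ) → (Fin (n ℓ) → ℝ))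
  | 0 => (fun x => x, fun _ => 0)
  | ℓ + 1 =>
      let F := (FG A b ℓ).1
      let G := (FG A b ℓ).2
      let G' := fun x => (matPos (A ℓ)).mulVec (G x) + (matNeg (A ℓ)).mulVec (F x)
      let H' := fun x => (matPos (A ℓ)).mulVec (F x) + (matNeg (A ℓ)).mulVec (G x) + b ℓ
      (fun x => vmax (H' x) (G' x), G')

/-- `f : ℝⁿ → ℝ` is a pointwise maximum of finitely many affine functions `x ↦ c·x + d`. -/
def IsMaxAffine {n : ℕ} (f : (Fin n → ℝ) → ℝ) : Prop :=
  ∃ (k : ℕ) (c : Fin (k + 1) → (Fin n → ℝ)) (d : Fin (k + 1) → ℝ),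
    ∀ x, f x = Finset.univ.sup' Finset.univ_nonempty (fun j => dotProduct (c j) x + d j)

theorem isMaxAffine_of {n : ℕ} {f : (Fin n → ℝ) → ℝ} {ι : Type} [Fintype ι]
    (c : ι → Fin n → ℝ) (d : ι → ℝ)
    (h : ∀ x, (∀ j, dotProduct (c j) x + d j ≤ f x) ∧ ∃ j, f x = dotProduct (c j) x + d j) :
    IsMaxAffine f := by
  obtain ⟨j0, -⟩ := (h 0).2
  have hc : Fintype.card ι = (Fintype.card ι - 1) + 1 := by
    have := Fintype.card_pos_iff.2 ⟨j0⟩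
    omega
  let e : ι ≃ Fin (Fintype.card ι - 1 + 1) := (Fintype.equivFin ι).trans (finCongr hc)
  refine ⟨Fintype.card ι - 1, fun k => c (e.symm k), fun k => d (e.symm k), fun x => ?_⟩
  apply le_antisymm
  · obtain ⟨j, hj⟩ := (h x).2
    rw [hj]
    have := Finset.le_sup' (fun k => dotProduct (c (e.symm k)) x + d (e.symm k))
      (Finset.mem_univ (e j))
    simp only [Equiv.symm_apply_apply] at this
    exact this
  · exact Finset.sup'_le _ _ fun k _ => (h x).1 _

theorem IsMaxAffine.spec {n : ℕ} {f : (Fin n → ℝ) → ℝ} (hf : IsMaxAffine f) :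
    ∃ (k : ℕ) (c : Fin (k + 1) → (Fin n → ℝ)) (d : Fin (k + 1) → ℝ),
    ∀ x, (∀ j, dotProduct (c j) x + d j ≤ f x) ∧ ∃ j, f x = dotProduct (c j) x + d j := by
  obtain ⟨k, c, d, h⟩ := hf
  refine ⟨k, c, d, fun x => ⟨fun j => ?_, ?_⟩⟩
  · rw [h]
    exact Finset.le_sup' (fun j => dotProduct (c j) x + d j) (Finset.mem_univ j)
  · obtain ⟨j, -, hj⟩ := Finset.exists_mem_eq_sup' Finset.univ_nonempty
      (fun j => dotProduct (c j) x + d j)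
    exact ⟨j, by rw [h, hj]⟩

theorem isMaxAffine_affine {n : ℕ} (c : Fin n → ℝ) (d : ℝ) :
    IsMaxAffine (fun x => dotProduct c x + d) :=
  isMaxAffine_of (ι := Unit) (fun _ => c) (fun _ => d) fun _ => ⟨fun _ => le_rfl, (), rfl⟩

theorem isMaxAffine_const {n : ℕ} (d : ℝ) : IsMaxAffine (fun _ : Fin n → ℝ => d) := by
  simpa using isMaxAffine_affine (0 : Fin n → ℝ) d

theorem IsMaxAffine.add {n : ℕ} {f g : (Fin n → ℝ) → ℝ} (hf : IsMaxAffine f)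
    (hg : IsMaxAffine g) : IsMaxAffine (fun x => f x + g x) := by
  obtain ⟨k, c, d, h⟩ := hf.spec
  obtain ⟨k', c', d', h'⟩ := hg.spec
  refine isMaxAffine_of (ι := Fin (k + 1) × Fin (k' + 1)) (fun p => c p.1 + c' p.2)
    (fun p => d p.1 + d' p.2) fun x => ⟨fun p => ?_, ?_⟩
  · have h1 := (h x).1 p.1
    have h2 := (h' x).1 p.2
    simp only [add_dotProduct]
    linarith
  · obtain ⟨j, hj⟩ := (h x).2
    obtain ⟨j', hj'⟩ := (h' x).2
    refine ⟨(j, j'), ?_⟩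
    simp only [add_dotProduct]
    linarith

theorem IsMaxAffine.max {n : ℕ} {f g : (Fin n → ℝ) → ℝ} (hf : IsMaxAffine f)
    (hg : IsMaxAffine g) : IsMaxAffine (fun x => max (f x) (g x)) := by
  obtain ⟨k, c, d, h⟩ := hf.spec
  obtain ⟨k', c', d', h'⟩ := hg.spec
  refine isMaxAffine_of (ι := Fin (k + 1) ⊕ Fin (k' + 1)) (Sum.elim c c')
    (Sum.elim d d') fun x => ⟨?_, ?_⟩
  · rintro (j | j)
    · exact ((h x).1 j).trans (le_max_left _ _)
    · exact ((h' x).1 j).trans (le_max_right _ _)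
  · rcases le_total (f x) (g x) with hle | hle
    · obtain ⟨j, hj⟩ := (h' x).2
      exact ⟨Sum.inr j, by rw [max_eq_right hle]; exact hj⟩
    · obtain ⟨j, hj⟩ := (h x).2
      exact ⟨Sum.inl j, by rw [max_eq_left hle]; exact hj⟩

theorem IsMaxAffine.smul {n : ℕ} {f : (Fin n → ℝ) → ℝ} (hf : IsMaxAffine f) {a : ℝ}
    (ha : 0 ≤ a) : IsMaxAffine (fun x => a * f x) := by
  obtain ⟨k, c, d, h⟩ := hf.spec
  refine isMaxAffine_of (fun j => a • c j) (fun j => a * d j) fun x => ⟨fun j => ?_, ?_⟩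
  · have := mul_le_mul_of_nonneg_left ((h x).1 j) ha
    simp only [smul_dotProduct, smul_eq_mul]
    linarith
  · obtain ⟨j, hj⟩ := (h x).2
    refine ⟨j, ?_⟩
    simp only [smul_dotProduct, smul_eq_mul, hj]
    ring

theorem IsMaxAffine.sum {n : ℕ} {ι : Type} (s : Finset ι) {f : ι → (Fin n → ℝ) → ℝ}
    (hf : ∀ i, IsMaxAffine (f i)) : IsMaxAffine (fun x => ∑ i ∈ s, f i x) := by
  classical
  induction s using Finset.induction_on with
  | empty => simpa using isMaxAffine_const (n := n) 0
  | insert a s ha ih =>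
    simp only [Finset.sum_insert ha]
    exact (hf a).add ih

theorem IsMaxAffine.mulVec {n m k : ℕ} {M : Matrix (Fin m) (Fin k) ℝ} (hM : ∀ i j, 0 ≤ M i j)
    {f : (Fin n → ℝ) → Fin k → ℝ} (hf : ∀ j, IsMaxAffine (fun x => f x j)) (i : Fin m) :
    IsMaxAffine (fun x => (M.mulVec (f x)) i) :=
  IsMaxAffine.sum Finset.univ (f := fun j x => M i j * f x j) fun j => (hf j).smul (hM i j)

theorem matPos_sub_matNeg {m n : ℕ} (A : Matrix (Fin m) (Fin n) ℝ) :
    A = matPos A - matNeg A := by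
  ext i j
  simp only [Matrix.sub_apply, matPos, matNeg]
  rcases le_total (A i j) 0 with h | h
  · rw [max_eq_right h, max_eq_left (by linarith)]; ring
  · rw [max_eq_left h, max_eq_right (by linarith)]; ring

/-- For an `L`-layer ReLU network, `ν^ℓ = F^ℓ − G^ℓ` for every `0 ≤ ℓ ≤ L`, and every
coordinate of `F^ℓ` and `G^ℓ` is a pointwise maximum of finitely many affine functions:
every ReLU network is a difference of two coordinatewise convex piecewise-linear
(tropical polynomial) maps. -/
theorem network_eq_tropical_rational {n : ℕ → ℕ}
    (A : ∀ ℓ : ℕ, Matrix (Fin (n (ℓ + 1))) (Fin (n ℓ)) ℝ)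
    (b : ∀ ℓ : ℕ, Fin (n (ℓ + 1)) → ℝ) (L : ℕ) (ℓ : ℕ) (hℓ : ℓ ≤ L) :
    nu A b ℓ = (FG A b ℓ).1 - (FG A b ℓ).2 ∧
    (∀ i, IsMaxAffine (fun x => (FG A b ℓ).1 x i)) ∧
    (∀ i, IsMaxAffine (fun x => (FG A b ℓ).2 x i)) := by
  clear hℓ
  induction ℓ with
  | zero =>
    refine ⟨?_, fun i => ?_, fun i => ?_⟩
    · ext x i
      simp [nu, FG]
    · simpa [FG] using isMaxAffine_affine (Pi.single i (1 : ℝ)) 0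
    · simpa [FG] using isMaxAffine_const (n := n 0) 0
  | succ ℓ ih =>
    obtain ⟨h1, h2, h3⟩ := ih
    have hp : ∀ i j, 0 ≤ matPos (A ℓ) i j := fun i j => le_max_right _ _
    have hn : ∀ i j, 0 ≤ matNeg (A ℓ) i j := fun i j => le_max_right _ _
    have hG : ∀ i, IsMaxAffine (fun x => (FG A b (ℓ + 1)).2 x i) := fun i =>
      (IsMaxAffine.mulVec hp h3 i).add (IsMaxAffine.mulVec hn h2 i)
    refine ⟨?_, fun i => ?_, hG⟩
    · ext x i
      have key : (A ℓ).mulVec (nu A b ℓ x) =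
          (matPos (A ℓ)).mulVec ((FG A b ℓ).1 x) + (matNeg (A ℓ)).mulVec ((FG A b ℓ).2 x)
          - ((matPos (A ℓ)).mulVec ((FG A b ℓ).2 x)
            + (matNeg (A ℓ)).mulVec ((FG A b ℓ).1 x)) := by
        conv_lhs => rw [matPos_sub_matNeg (A ℓ), h1]
        rw [Pi.sub_apply, Matrix.sub_mulVec, Matrix.mulVec_sub, Matrix.mulVec_sub]
        abel
      simp only [nu, FG, relu, vmax, key, Pi.sub_apply, Pi.add_apply]
      rw [← max_sub_sub_right, sub_self]
      congr 1
      ring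
    · exact (((IsMaxAffine.mulVec hp h2 i).add (IsMaxAffine.mulVec hn h3 i)).add
        (isMaxAffine_const (b ℓ i))).max (hG i)
end

section
/- Consider a ReLU network with skip connections, a layer index ℓ with skip set K = K_{ℓ+1}, and functions F^(k), G^(k) : ℝ^{n_0} → ℝ^{n_k} with ν^(k) = F^(k) − G^(k) for all k ≤ ℓ. Define G^(ℓ+1)(x) = A^(ℓ+1)₊G^(ℓ)(x) + A^(ℓ+1)₋F^(ℓ)(x) + A^(ℓ+1)₋Σ_{k∈K}(F^(k)(x) − G^(k)(x)), H^(ℓ+1)(x) = A^(ℓ+1)₊F^(ℓ)(x) + A^(ℓ+1)₋G^(ℓ)(x) + A^(ℓ+1)₊Σ_{k∈K}(F^(k)(x) − G^(k)(x)) + b^(ℓ+1), and F^(ℓ+1)(x) = max(H^(ℓ+1)(x), G^(ℓ+1)(x)) componentwise. Then for every x ∈ ℝ^{n_0}, the pre-activation satisfies ρ^(ℓ+1)(x) = H^(ℓ+1)(x) − G^(ℓ+1)(x) and the post-activation satisfies ν^(ℓ+1)(x) = F^(ℓ+1)(x) − G^(ℓ+1)(x). -/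
open Matrix

/-- Skip-connection layer recurrence: with `K = K_{ℓ+1} ⊆ {1, …, ℓ}` the skip set of
layer `ℓ+1` (all skipped layers having the same width `p = n ℓ` as layer `ℓ`),
post-activation outputs `ν k = F k − G k` for `k ≤ ℓ`, and
`G' = A₊ G^ℓ + A₋ F^ℓ + A₋ Σ_{k∈K}(F^k − G^k)`,
`H' = A₊ F^ℓ + A₋ G^ℓ + A₊ Σ_{k∈K}(F^k − G^k) + b`,
`F' = max (H', G')` componentwise, the pre-activation of layer `ℓ+1`,
`ρ^{ℓ+1}(x) = A (ν^ℓ(x) + Σ_{k∈K} ν^k(x)) + b`, equals `H'(x) − G'(x)`, and the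
post-activation `ν^{ℓ+1}(x) = ReLU (ρ^{ℓ+1}(x))` equals `F'(x) − G'(x)`. -/
theorem skip_layer_tropical_decomposition {n0 p q : ℕ} (ℓ : ℕ)
    (K : Finset ℕ) (hK : ∀ k ∈ K, 1 ≤ k ∧ k ≤ ℓ)
    (ν F G : ℕ → (Fin n0 → ℝ) → (Fin p → ℝ))
    (hν : ∀ k ≤ ℓ, ν k = F k - G k)
    (A : Matrix (Fin q) (Fin p) ℝ) (b : Fin q → ℝ)
    (G' H' F' : (Fin n0 → ℝ) → (Fin q → ℝ))
    (hG' : ∀ x, G' x = (matPos A).mulVec (G ℓ x) + (matNeg A).mulVec (F ℓ x) +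
        (matNeg A).mulVec (∑ k ∈ K, (F k x - G k x)))
    (hH' : ∀ x, H' x = (matPos A).mulVec (F ℓ x) + (matNeg A).mulVec (G ℓ x) +
        (matPos A).mulVec (∑ k ∈ K, (F k x - G k x)) + b)
    (hF' : ∀ x, F' x = vmax (H' x) (G' x)) :
    ∀ x : Fin n0 → ℝ,
      A.mulVec (ν ℓ x + ∑ k ∈ K, ν k x) + b = H' x - G' x ∧
      relu (A.mulVec (ν ℓ x + ∑ k ∈ K, ν k x) + b) = F' x - G' x := by
  intro x
  have hA : A = matPos A - matNeg A := by
    ext i j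
    simp only [matPos, matNeg, Matrix.sub_apply]
    rcases le_total (A i j) 0 with h | h
    · rw [max_eq_right h, max_eq_left (by linarith)]; ring
    · rw [max_eq_left h, max_eq_right (by linarith)]; ring
  have hs : ∑ k ∈ K, ν k x = ∑ k ∈ K, (F k x - G k x) :=
    Finset.sum_congr rfl fun k hk => by rw [hν k (hK k hk).2]; rfl
  have hl : ν ℓ x = F ℓ x - G ℓ x := by rw [hν ℓ le_rfl]; rfl
  have h1 : A.mulVec (ν ℓ x + ∑ k ∈ K, ν k x) + b = H' x - G' x := by
    rw [hs, hl, hG', hH']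
    generalize ∑ k ∈ K, (F k x - G k x) = S
    have e : ∀ v, A.mulVec v = (matPos A).mulVec v - (matNeg A).mulVec v := by
      intro v
      rw [← Matrix.sub_mulVec, ← hA]
    rw [e]
    simp only [Matrix.mulVec_add, Matrix.mulVec_sub]
    abel
  refine ⟨h1, ?_⟩
  rw [h1, hF']
  ext i
  simp only [relu, vmax, Pi.sub_apply]
  rw [← max_sub_sub_right, sub_self]
end
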